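/- Let Y be an ℝ^d-valued random variable with E[Y] = 0, and let λ ∈ ℝ^d. If E[‖Y‖² · exp(‖λ‖·‖Y‖)] < ∞, then E[exp(⟨λ, Y⟩)] ≤ 1 + (‖λ‖²/2) · E[‖Y‖² · exp(‖λ‖·‖Y‖)]. -/

import Mathlib

open MeasureTheory Real
open scoped ENNReal RealInnerProductSpace

theorem exp_le_one_add_add_sq_mul_exp_of_nonneg {u : ℝ} (hu : 0 ≤ u) :
    exp u ≤ 1 + u + u ^ 2 / 2 * exp u := by
  have hmono : Monotone fun x : ℝ => (1 + x) * exp (-x) + x ^ 2 / 2 := by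
    have hderiv (x : ℝ) : HasDerivAt (fun x : ℝ => (1 + x) * exp (-x) + x ^ 2 / 2)
        (x * (1 - exp (-x))) x := by
      refine ((((hasDerivAt_id' x).const_add 1).mul (hasDerivAt_neg x).exp).add
        ((hasDerivAt_pow 2 x).div_const 2)).congr_deriv ?_
      push_cast
      ring
    refine monotone_of_deriv_nonneg (fun x => (hderiv x).differentiableAt) fun x => ?_
    rw [(hderiv x).deriv]
    rcases le_total 0 x with hx | hx
    · exact mul_nonneg hx (sub_nonneg.2 (exp_le_one_iff.2 (by linarith)))
    · exact mul_nonneg_of_nonpos_of_nonpos hx (sub_nonpos.2 (one_le_exp (by linarith)))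
  have h : 1 ≤ (1 + u) * exp (-u) + u ^ 2 / 2 := by simpa using hmono hu
  calc exp u = 1 * exp u := (one_mul _).symm
    _ ≤ ((1 + u) * exp (-u) + u ^ 2 / 2) * exp u := by gcongr
    _ = 1 + u + u ^ 2 / 2 * exp u := by
      rw [add_mul, mul_assoc, ← exp_add, neg_add_cancel, exp_zero, mul_one]

theorem exp_le_one_add_add_sq_mul_exp_abs (x : ℝ) :
    exp x ≤ 1 + x + x ^ 2 / 2 * exp |x| := by
  have h := Complex.norm_exp_sub_sum_le_exp_norm_sub_sum (x : ℂ) 2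
  have hx : |exp x - (1 + x)| ≤ exp |x| - (1 + |x|) := by
    simp only [Finset.sum_range_succ, Finset.sum_range_zero, Nat.factorial, Complex.norm_real,
      norm_eq_abs, zero_add, pow_zero, pow_one, Nat.cast_one, mul_one, div_one] at h
    exact_mod_cast h
  have habs := exp_le_one_add_add_sq_mul_exp_of_nonneg (abs_nonneg x)
  rw [sq_abs] at habs
  linarith [le_abs_self (exp x - (1 + x))]

theorem exp_inner_le_one_add_inner_add {E : Type*} [NormedAddCommGroup E] [InnerProductSpace ℝ E]
    (l y : E) :
    exp ⟪l, y⟫ ≤ 1 + ⟪l, y⟫ + ‖l‖ ^ 2 / 2 * (‖y‖ ^ 2 * exp (‖l‖ * ‖y‖)) := by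
  have hinner : |⟪l, y⟫| ≤ ‖l‖ * ‖y‖ := abs_real_inner_le_norm l y
  calc exp ⟪l, y⟫ ≤ 1 + ⟪l, y⟫ + |⟪l, y⟫| ^ 2 / 2 * exp |⟪l, y⟫| := by
        rw [sq_abs]
        exact exp_le_one_add_add_sq_mul_exp_abs _
    _ ≤ 1 + ⟪l, y⟫ + (‖l‖ * ‖y‖) ^ 2 / 2 * exp (‖l‖ * ‖y‖) := by gcongr
    _ = _ := by ring

/-- Let `Y` be an `ℝ^d`-valued random variable with `E[Y] = 0` and let
`λ ∈ ℝ^d`. If `E[‖Y‖²·exp(‖λ‖·‖Y‖)] < ∞`, then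
`E[exp(⟨λ, Y⟩)] ≤ 1 + (‖λ‖²/2) · E[‖Y‖²·exp(‖λ‖·‖Y‖)]`. -/
theorem mgf_bound_of_mean_zero
    {Ω : Type*} [MeasurableSpace Ω] (P : Measure Ω) [IsProbabilityMeasure P]
    {d : ℕ} (Y : Ω → EuclideanSpace ℝ (Fin d)) (hYmeas : Measurable Y)
    (hYint : Integrable Y P) (hYmean : ∫ ω, Y ω ∂P = 0)
    (l : EuclideanSpace ℝ (Fin d))
    (hfin : Integrable (fun ω => ‖Y ω‖ ^ 2 * exp (‖l‖ * ‖Y ω‖)) P) :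
    ∫ ω, exp (⟪l, Y ω⟫) ∂P
      ≤ 1 + (‖l‖ ^ 2 / 2) * ∫ ω, ‖Y ω‖ ^ 2 * exp (‖l‖ * ‖Y ω‖) ∂P := by
  have hinner : Integrable (fun ω => ⟪l, Y ω⟫) P := hYint.const_inner l
  have hlin : Integrable (fun ω => 1 + ⟪l, Y ω⟫) P := (integrable_const 1).add hinner
  have hsq := hfin.const_mul (‖l‖ ^ 2 / 2)
  have hmean : ∫ ω, ⟪l, Y ω⟫ ∂P = 0 := by
    rw [integral_inner hYint, hYmean, inner_zero_right]
  calc ∫ ω, exp ⟪l, Y ω⟫ ∂P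
      ≤ ∫ ω, (1 + ⟪l, Y ω⟫ + ‖l‖ ^ 2 / 2 * (‖Y ω‖ ^ 2 * exp (‖l‖ * ‖Y ω‖))) ∂P :=
        integral_mono_of_nonneg (.of_forall fun _ => (exp_pos _).le) (hlin.add hsq)
          (.of_forall fun ω => exp_inner_le_one_add_inner_add l (Y ω))
    _ = 1 + (‖l‖ ^ 2 / 2) * ∫ ω, ‖Y ω‖ ^ 2 * exp (‖l‖ * ‖Y ω‖) ∂P := by
        rw [integral_add hlin hsq, integral_add (integrable_const 1) hinner, hmean,
          integral_const_mul]
        simp
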